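/- Let f : ℂ → ℂ be holomorphic and injective on the open unit disc 𝔻 = {z ∈ ℂ : |z| < 1}, with f(0) = 0 and f'(0) = 1. Then the second Taylor coefficient b₂ = f''(0)/2 of f at 0 satisfies |b₂| ≤ 2. -/

import Mathlib

open Set Metric MeasureTheory Complex Filter Topology ComplexConjugate

/-- The squared norm of `-z⁻² + ψ z`, averaged over a circle, is at least the contribution of the
terms of degree `-2` and `0` of its Laurent expansion. -/
theorem two_pi_mul_le_integral_normSq_circle {ψ : ℂ → ℂ} (hψ : DifferentiableOn ℂ ψ (ball 0 1))
    {ρ : ℝ} (hρ : 0 < ρ) (hρ1 : ρ < 1) :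
    2 * Real.pi * ((ρ ^ 4)⁻¹ + ‖ψ 0‖ ^ 2) ≤
      ∫ θ in (-Real.pi)..Real.pi,
        ‖-(circleMap 0 ρ θ ^ 2)⁻¹ + ψ (circleMap 0 ρ θ)‖ ^ 2 := by
  set L : ℂ → ℂ := fun z ↦
    ((ρ ^ 4)⁻¹ : ℝ) - 2 * ((ρ ^ 4)⁻¹ : ℝ) * (z ^ 2 * ψ z) + 2 * conj (ψ 0) * ψ z
      - (‖ψ 0‖ ^ 2 : ℝ) with hL
  have hLd : DifferentiableOn ℂ L (ball 0 1) := by fun_prop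
  have hmem (θ : ℝ) : circleMap 0 ρ θ ∈ ball (0 : ℂ) 1 := by simp [abs_of_pos hρ, hρ1]
  have hLc : Continuous fun θ : ℝ ↦ L (circleMap 0 ρ θ) :=
    hLd.continuousOn.comp_continuous (continuous_circleMap 0 ρ) hmem
  have hψc : Continuous fun θ : ℝ ↦ ψ (circleMap 0 ρ θ) :=
    hψ.continuousOn.comp_continuous (continuous_circleMap 0 ρ) hmem
  have hne (θ : ℝ) : circleMap 0 ρ θ ^ 2 ≠ 0 := by simp [hρ.ne']
  have hmean : ∫ θ in (-Real.pi)..Real.pi, L (circleMap 0 ρ θ) = 2 * Real.pi * L 0 := by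
    have h1 : Real.circleAverage L 0 ρ = L 0 := by
      apply DiffContOnCl.circleAverage
      refine DifferentiableOn.diffContOnCl (hLd.mono ?_)
      exact closure_ball_subset_closedBall.trans
        (closedBall_subset_ball (by simpa [abs_of_pos hρ] using hρ1))
    rw [Real.circleAverage_eq_integral_add (-Real.pi), intervalIntegral.integral_comp_add_right
      (fun θ ↦ L (circleMap 0 ρ θ)), inv_smul_eq_iff₀ (by positivity)] at h1
    rw [zero_add, show 2 * Real.pi + -Real.pi = Real.pi by ring] at h1
    rw [h1]
    simp
  have hL0 : (L 0).re = (ρ ^ 4)⁻¹ + ‖ψ 0‖ ^ 2 := by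
    have : L 0 = (((ρ ^ 4)⁻¹ + ‖ψ 0‖ ^ 2 : ℝ) : ℂ) := by
      simp only [hL, mul_assoc, conj_mul']
      push_cast
      ring
    rw [this, ofReal_re]
  have hre : ∫ θ in (-Real.pi)..Real.pi, (L (circleMap 0 ρ θ)).re
      = 2 * Real.pi * ((ρ ^ 4)⁻¹ + ‖ψ 0‖ ^ 2) := by
    have := reCLM.intervalIntegral_comp_comm
      (hLc.intervalIntegrable (μ := volume) (-Real.pi) Real.pi)
    simp only [reCLM_apply] at this
    rw [this, hmean, ← hL0]
    simp
  rw [← hre]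
  refine intervalIntegral.integral_mono_on (by linarith [Real.pi_pos])
    ((continuous_re.comp hLc).intervalIntegrable _ _) (Continuous.intervalIntegrable ?_ _ _) ?_
  · exact ((((continuous_circleMap 0 ρ).pow 2).inv₀ hne).neg.add hψc).norm.pow 2
  · intro θ _
    set z := circleMap 0 ρ θ
    have hz : ‖z‖ = ρ := by simp [z, abs_of_pos hρ]
    have key : ‖-(z ^ 2)⁻¹ + ψ z‖ ^ 2 = (L z).re + ‖ψ z - ψ 0‖ ^ 2 := by
      have h1 : -(z ^ 2)⁻¹ = -(((ρ ^ 4)⁻¹ : ℝ) * conj (z ^ 2)) := by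
        rw [inv_def, normSq_eq_norm_sq, norm_pow, hz]
        push_cast; ring
      have h2 : (ρ ^ 4)⁻¹ ^ 2 * ‖z ^ 2‖ ^ 2 = (ρ ^ 4)⁻¹ := by
        rw [norm_pow, hz]; field_simp
      simp only [hL, h1, mul_assoc]
      generalize (ρ ^ 4)⁻¹ = t at *
      generalize z ^ 2 = w at *
      generalize ψ z = u at *
      generalize ψ 0 = c at *
      rw [← normSq_eq_norm_sq] at h2 ⊢
      rw [← normSq_eq_norm_sq, ← normSq_eq_norm_sq]
      simp [normSq_apply] at h2 ⊢
      linear_combination h2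
    rw [key]
    nlinarith [sq_nonneg ‖ψ z - ψ 0‖]

/-- Integration over an annulus in polar coordinates. -/
theorem setIntegral_annulus_eq_setIntegral_circleMap (φ : ℂ → ℝ) {ε : ℝ} (hε : 0 < ε) (r : ℝ) :
    ∫ z in {z : ℂ | ε < ‖z‖ ∧ ‖z‖ < r}, φ z =
      ∫ p in Ioo ε r ×ˢ Ioo (-Real.pi) Real.pi, p.1 * φ (circleMap 0 p.1 p.2) := by
  have hA : MeasurableSet {z : ℂ | ε < ‖z‖ ∧ ‖z‖ < r} :=
    (measurableSet_lt measurable_const measurable_norm).inter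
      (measurableSet_lt measurable_norm measurable_const)
  have hB : MeasurableSet (Ioo ε r ×ˢ Ioo (-Real.pi) Real.pi) :=
    measurableSet_Ioo.prod measurableSet_Ioo
  have hT : MeasurableSet (Ioi (0 : ℝ) ×ˢ Ioo (-Real.pi) Real.pi) :=
    measurableSet_Ioi.prod measurableSet_Ioo
  rw [← integral_indicator hA, ← Complex.integral_comp_polarCoord_symm, polarCoord_target,
    ← integral_indicator hB, ← integral_indicator hT]
  congr 1
  ext ⟨ρ, θ⟩
  have hc : Complex.polarCoord.symm (ρ, θ) = circleMap 0 ρ θ := by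
    simp [circleMap, Complex.polarCoord_symm_apply, exp_mul_I]
  by_cases hρ : 0 < ρ
  · simp [indicator_apply, hc, abs_of_pos hρ, hρ, -Complex.polarCoord_symm_apply]
    grind
  · have : ¬ ε < ρ := fun h ↦ hρ (hε.trans h)
    simp [indicator_apply, hρ, this]

theorem det_id_sub_smul_conj (a : ℂ) :
    LinearMap.det (LinearMap.id - a • conjAe.toLinearMap : ℂ →ₗ[ℝ] ℂ) = 1 - ‖a‖ ^ 2 := by
  rw [← LinearMap.det_toMatrix basisOneI, Matrix.det_fin_two, ← normSq_eq_norm_sq]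
  simp [LinearMap.toMatrix_apply, normSq_apply]
  ring

theorem setIntegral_normSq_deriv_eq_volume_image {G G' : ℂ → ℂ} {A : Set ℂ} (hA : MeasurableSet A)
    (hG : ∀ z ∈ A, HasDerivAt G (G' z) z) (hinj : InjOn G A) :
    ∫ z in A, ‖G' z‖ ^ 2 = volume.real (G '' A) := by
  have := integral_image_eq_integral_abs_det_fderiv_smul volume hA
    (fun z hz ↦ ((hG z hz).hasFDerivAt.restrictScalars ℝ).hasFDerivWithinAt) hinj
    (fun _ ↦ (1 : ℝ))
  simp only [setIntegral_const, smul_eq_mul, mul_one] at this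
  rw [this]
  congr 1
  ext z
  simp [ContinuousLinearMap.det, LinearMap.det_restrictScalars, Algebra.norm_complex_eq,
    normSq_eq_norm_sq]

/-- Lower bound for the Dirichlet integral of `z⁻¹ + h z` over an annulus, where `ψ` is the derivative of `h`. -/
theorem pi_mul_le_setIntegral_annulus {ψ : ℂ → ℂ} (hψ : DifferentiableOn ℂ ψ (ball 0 1))
    {ε r : ℝ} (hε : 0 < ε) (hεr : ε < r) (hr : r < 1) :
    Real.pi * ((ε ^ 2)⁻¹ - (r ^ 2)⁻¹ + ‖ψ 0‖ ^ 2 * (r ^ 2 - ε ^ 2)) ≤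
      ∫ z in {z : ℂ | ε < ‖z‖ ∧ ‖z‖ < r}, ‖-(z ^ 2)⁻¹ + ψ z‖ ^ 2 := by
  set F : ℝ × ℝ → ℝ := fun p ↦
    p.1 * ‖-(circleMap 0 p.1 p.2 ^ 2)⁻¹ + ψ (circleMap 0 p.1 p.2)‖ ^ 2 with hF
  have hcm : Continuous fun p : ℝ × ℝ ↦ circleMap 0 p.1 p.2 := by
    unfold circleMap; fun_prop
  have hFc : ContinuousOn F (Icc ε r ×ˢ Icc (-Real.pi) Real.pi) := by
    refine continuous_fst.continuousOn.mul (ContinuousOn.pow (ContinuousOn.norm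
      (ContinuousOn.add (ContinuousOn.neg (ContinuousOn.inv₀ (hcm.continuousOn.pow 2) ?_))
        (hψ.continuousOn.comp hcm.continuousOn ?_))) 2)
    · rintro ⟨ρ, θ⟩ ⟨hρ, -⟩
      simp [(hε.trans_le hρ.1).ne']
    · rintro ⟨ρ, θ⟩ ⟨hρ, -⟩
      simpa [abs_of_pos (hε.trans_le hρ.1)] using hρ.2.trans_lt hr
  have hFi : IntegrableOn F (Ioo ε r ×ˢ Ioo (-Real.pi) Real.pi) (volume.prod volume) :=
    (hFc.integrableOn_compact (isCompact_Icc.prod isCompact_Icc)).mono_set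
      (prod_mono Ioo_subset_Icc_self Ioo_subset_Icc_self)
  have hFi' : IntegrableOn (fun ρ ↦ ∫ θ in Ioo (-Real.pi) Real.pi, F (ρ, θ)) (Ioo ε r) := by
    rw [IntegrableOn, ← Measure.prod_restrict] at hFi
    exact hFi.integral_prod_left
  have hgc : ContinuousOn (fun ρ : ℝ ↦ 2 * Real.pi * ((ρ ^ 3)⁻¹ + ‖ψ 0‖ ^ 2 * ρ)) (Icc ε r) := by
    refine continuousOn_const.mul (ContinuousOn.add (ContinuousOn.inv₀ (by fun_prop) ?_)
      (by fun_prop))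
    intro ρ hρ
    exact pow_ne_zero 3 (hε.trans_le hρ.1).ne'
  have hint : ∫ ρ in Ioo ε r, 2 * Real.pi * ((ρ ^ 3)⁻¹ + ‖ψ 0‖ ^ 2 * ρ) =
      Real.pi * ((ε ^ 2)⁻¹ - (r ^ 2)⁻¹ + ‖ψ 0‖ ^ 2 * (r ^ 2 - ε ^ 2)) := by
    rw [← integral_Ioc_eq_integral_Ioo, ← intervalIntegral.integral_of_le hεr.le,
      intervalIntegral.integral_eq_sub_of_hasDerivAt
        (f := fun ρ ↦ Real.pi * (-(ρ ^ 2)⁻¹ + ‖ψ 0‖ ^ 2 * ρ ^ 2))]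
    · ring
    · intro ρ hρ
      rw [uIcc_of_le hεr.le] at hρ
      have hρ0 : ρ ≠ 0 := (hε.trans_le hρ.1).ne'
      have h1 := (((hasDerivAt_pow 2 ρ).fun_inv (pow_ne_zero 2 hρ0)).neg.add
        ((hasDerivAt_pow 2 ρ).const_mul (‖ψ 0‖ ^ 2))).const_mul Real.pi
      refine h1.congr_deriv ?_
      field_simp
      norm_num
      ring
    · exact ContinuousOn.intervalIntegrable (by rwa [uIcc_of_le hεr.le])
  rw [setIntegral_annulus_eq_setIntegral_circleMap _ hε, ← hint]
  change _ ≤ ∫ p in Ioo ε r ×ˢ Ioo (-Real.pi) Real.pi, F p ∂(volume.prod volume)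
  rw [setIntegral_prod F hFi]
  refine setIntegral_mono_on (hgc.integrableOn_Icc.mono_set Ioo_subset_Icc_self) hFi'
    measurableSet_Ioo fun ρ hρ ↦ ?_
  have hρ0 : 0 < ρ := hε.trans hρ.1
  simp only [hF]
  rw [integral_const_mul, ← integral_Ioc_eq_integral_Ioo,
    ← intervalIntegral.integral_of_le (by linarith [Real.pi_pos])]
  calc 2 * Real.pi * ((ρ ^ 3)⁻¹ + ‖ψ 0‖ ^ 2 * ρ)
      = ρ * (2 * Real.pi * ((ρ ^ 4)⁻¹ + ‖ψ 0‖ ^ 2)) := by field_simp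
    _ ≤ _ := mul_le_mul_of_nonneg_left
      (two_pi_mul_le_integral_normSq_circle hψ hρ0 (hρ.2.trans hr)) hρ0.le

/-- The real-linear map straightening the ellipse `{z⁻¹ + c * z : ‖z‖ = ε}` sends `z⁻¹ + c * z + q`,
for `ε < ‖z‖ < 1` and `q` small of second order, into a disc of radius close to `ε⁻¹`. -/
theorem norm_sub_smul_conj_le {c q z : ℂ} {C D ε : ℝ} (hε : 0 < ε) (hεz : ε < ‖z‖) (hz : ‖z‖ < 1)
    (hq : ‖q‖ ≤ C * ‖z‖ ^ 2) (hcD : ‖c‖ ≤ D) (hCD : C ≤ D) (hD : ‖c‖ * (‖c‖ + C) ≤ D)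
    (hDε : 6 * D * ε ≤ 1) :
    ‖(z⁻¹ + c * z + q) - c * ε ^ 2 * conj (z⁻¹ + c * z + q)‖ ≤ ε⁻¹ + 2 * D * ε ^ 2 := by
  have hz0 : z ≠ 0 := norm_pos_iff.1 (hε.trans hεz)
  set ρ := ‖z‖ with hρ
  have hρ0 : 0 < ρ := hε.trans hεz
  have hD0 : 0 ≤ D := (norm_nonneg c).trans hcD
  have hconj : conj (z⁻¹) = z * ((ρ ^ 2)⁻¹ : ℝ) := by
    rw [inv_def, normSq_eq_norm_sq]; simp [← hρ]
  have heq : (z⁻¹ + c * z + q) - c * ε ^ 2 * conj (z⁻¹ + c * z + q) =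
      z⁻¹ + c * z * ((1 - ε ^ 2 * (ρ ^ 2)⁻¹ : ℝ) : ℂ) + q -
        c * ((ε ^ 2 : ℝ) : ℂ) * conj (c * z + q) := by
    rw [add_assoc, map_add, hconj]; push_cast; ring
  have hpos : 0 ≤ 1 - ε ^ 2 * (ρ ^ 2)⁻¹ := by
    rw [sub_nonneg, ← div_eq_mul_inv, div_le_one (by positivity)]
    gcongr
  have hcq : ‖c * z + q‖ ≤ (‖c‖ + C) * ρ := by
    have hC : 0 ≤ C := by
      have := (norm_nonneg q).trans hq
      exact nonneg_of_mul_nonneg_left this (by positivity)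
    calc ‖c * z + q‖ ≤ ‖c‖ * ρ + C * ρ ^ 2 := by
          refine (norm_add_le _ _).trans ?_
          rw [norm_mul]
          gcongr
      _ ≤ _ := by nlinarith [mul_nonneg hC hρ0.le]
  have hle : ‖(z⁻¹ + c * z + q) - c * ε ^ 2 * conj (z⁻¹ + c * z + q)‖ ≤
      ρ⁻¹ + D * ρ * (1 - ε ^ 2 * (ρ ^ 2)⁻¹) + D * ρ ^ 2 + D * (ε ^ 2 * ρ) := by
    rw [heq]
    refine (norm_sub_le _ _).trans (add_le_add ((norm_add₃_le).trans ?_) ?_)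
    · rw [norm_inv, norm_mul, norm_mul, norm_real, Real.norm_of_nonneg hpos]
      gcongr
      exact hq.trans (by gcongr)
    · rw [norm_mul, norm_mul, norm_real, Real.norm_of_nonneg (by positivity), RCLike.norm_conj]
      calc ‖c‖ * ε ^ 2 * ‖c * z + q‖ ≤ ‖c‖ * ε ^ 2 * ((‖c‖ + C) * ρ) := by gcongr
        _ = ‖c‖ * (‖c‖ + C) * (ε ^ 2 * ρ) := by ring
        _ ≤ _ := by gcongr
  refine hle.trans ?_
  have h1 : D * ρ * (1 - ε ^ 2 * (ρ ^ 2)⁻¹) ≤ 2 * D * (ρ - ε) := by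
    have : D * ρ * (1 - ε ^ 2 * (ρ ^ 2)⁻¹) = D * (ρ - ε) * ((ρ + ε) / ρ) := by field_simp; ring
    rw [this]
    have h2 : (ρ + ε) / ρ ≤ 2 := by rw [div_le_iff₀ hρ0]; linarith
    nlinarith [mul_nonneg hD0 (sub_nonneg.2 hεz.le)]
  have h2 : D * ρ ^ 2 + D * (ε ^ 2 * ρ) ≤ 4 * D * (ρ - ε) + 2 * D * ε ^ 2 := by
    have h3 : ρ ^ 2 + ε ^ 2 * ρ ≤ 4 * (ρ - ε) + 2 * ε ^ 2 := by nlinarith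
    nlinarith
  have h3 : 6 * D * (ρ - ε) ≤ ε⁻¹ - ρ⁻¹ := by
    have : ε⁻¹ - ρ⁻¹ = (ρ - ε) * (ε⁻¹ * ρ⁻¹) := by field_simp
    rw [this]
    have h4 : 6 * D ≤ ε⁻¹ := by rwa [← one_div, le_div_iff₀ hε]
    have h5 : 1 ≤ ρ⁻¹ := (one_le_inv₀ hρ0).2 hz.le
    have h6 : 6 * D ≤ ε⁻¹ * ρ⁻¹ := h4.trans (le_mul_of_one_le_right (by positivity) h5)
    nlinarith
  linarith

/-- A holomorphic function on the unit disc is, on a smaller disc, its first order Taylor polynomial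
up to a quadratic error. -/
theorem exists_norm_sub_le_mul_sq {h : ℂ → ℂ} (hh : DifferentiableOn ℂ h (ball 0 1)) {r : ℝ}
    (hr : r < 1) : ∃ C, ∀ z, ‖z‖ ≤ r → ‖h z - h 0 - deriv h 0 * z‖ ≤ C * ‖z‖ ^ 2 := by
  have hb : ball (0 : ℂ) 1 ∈ nhds 0 := ball_mem_nhds _ one_pos
  have hd : DifferentiableOn ℂ (dslope (dslope h 0) 0) (ball 0 1) :=
    (differentiableOn_dslope hb).2 ((differentiableOn_dslope hb).2 hh)
  obtain ⟨C, hC⟩ := (isCompact_closedBall (0 : ℂ) r).exists_bound_of_continuousOn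
    (hd.continuousOn.mono (closedBall_subset_ball hr))
  refine ⟨C, fun z hz ↦ ?_⟩
  have h1 := sub_smul_dslope h 0 z
  have h2 := sub_smul_dslope (dslope h 0) 0 z
  simp only [sub_zero, smul_eq_mul, dslope_same] at h1 h2
  have h3 : h z - h 0 - deriv h 0 * z = dslope (dslope h 0) 0 z * z ^ 2 := by
    linear_combination -h1 - z * h2
  rw [h3, norm_mul, norm_pow]
  gcongr
  exact hC z (by simpa using hz)

/-- Area comparison for the image of the annulus `ε < ‖z‖ < r` under an injective map `z⁻¹ + h z`:
the image lies in a region bounded by a curve close to an ellipse. -/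
theorem one_sub_mul_le_of_injOn_inv_add {h : ℂ → ℂ} (hh : DifferentiableOn ℂ h (ball 0 1))
    (hinj : InjOn (fun z ↦ z⁻¹ + h z) (ball 0 1 \ {0})) {C D ε r : ℝ} (hr : r < 1)
    (hC : ∀ z, ‖z‖ ≤ r → ‖h z - h 0 - deriv h 0 * z‖ ≤ C * ‖z‖ ^ 2)
    (hcD : ‖deriv h 0‖ ≤ D) (hCD : C ≤ D) (hD : ‖deriv h 0‖ * (‖deriv h 0‖ + C) ≤ D)
    (hε : 0 < ε) (hεr : ε < r) (hDε : 6 * D * ε ≤ 1) :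
    (1 - ‖deriv h 0‖ ^ 2 * ε ^ 4) *
        ((ε ^ 2)⁻¹ - (r ^ 2)⁻¹ + ‖deriv h 0‖ ^ 2 * (r ^ 2 - ε ^ 2)) ≤
      (ε⁻¹ + 2 * D * ε ^ 2) ^ 2 := by
  set c := deriv h 0 with hc
  set A : Set ℂ := {z : ℂ | ε < ‖z‖ ∧ ‖z‖ < r}
  set G : ℂ → ℂ := fun z ↦ z⁻¹ + h z - h 0 with hG
  set R : ℝ := ε⁻¹ + 2 * D * ε ^ 2 with hR
  set M : ℂ →ₗ[ℝ] ℂ := LinearMap.id - (c * ε ^ 2) • conjAe.toLinearMap with hM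
  have hD0 : 0 ≤ D := (norm_nonneg c).trans hcD
  have hAm : MeasurableSet A :=
    (measurableSet_lt measurable_const measurable_norm).inter
      (measurableSet_lt measurable_norm measurable_const)
  have hAb {z : ℂ} (hz : z ∈ A) : z ∈ ball (0 : ℂ) 1 \ {0} :=
    ⟨by simpa using hz.2.trans hr, norm_pos_iff.1 (hε.trans hz.1)⟩
  have hGd : ∀ z ∈ A, HasDerivAt G (-(z ^ 2)⁻¹ + deriv h z) z := fun z hz ↦
    ((hasDerivAt_inv (hAb hz).2).add
      (hh.differentiableAt (isOpen_ball.mem_nhds (hAb hz).1)).hasDerivAt).sub_const _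
  have hGinj : InjOn G A := fun z hz w hw hzw ↦
    hinj (hAb hz) (hAb hw) (sub_left_injective hzw)
  have hlow := pi_mul_le_setIntegral_annulus (hh.deriv isOpen_ball) hε hεr hr
  rw [setIntegral_normSq_deriv_eq_volume_image hAm hGd hGinj] at hlow
  have hsub : M '' (G '' A) ⊆ closedBall 0 R := by
    rintro _ ⟨_, ⟨z, hz, rfl⟩, rfl⟩
    rw [mem_closedBall_zero_iff]
    have hGz : G z = z⁻¹ + c * z + (h z - h 0 - c * z) := by simp only [hG]; ring
    rw [hGz]
    exact norm_sub_smul_conj_le hε hz.1 (hz.2.trans hr) (hC z hz.2.le) hcD hCD hD hDε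
  have hdet : LinearMap.det M = 1 - ‖c‖ ^ 2 * ε ^ 4 := by
    rw [hM, det_id_sub_smul_conj, norm_mul, norm_pow, norm_real, Real.norm_of_nonneg hε.le]
    ring
  have hcε : 0 ≤ 1 - ‖c‖ ^ 2 * ε ^ 4 := by
    have h1 : ‖c‖ * ε ≤ 1 := by nlinarith
    have h2 : ‖c‖ * ε ^ 2 ≤ 1 := by nlinarith
    have h3 : 0 ≤ ‖c‖ * ε ^ 2 := by positivity
    nlinarith
  have hvol : (1 - ‖c‖ ^ 2 * ε ^ 4) * volume.real (G '' A) ≤ R ^ 2 * Real.pi := by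
    have h1 := measureReal_mono (μ := volume) hsub measure_closedBall_lt_top.ne
    rw [measureReal_def, Measure.addHaar_image_linearMap, ENNReal.toReal_mul, hdet,
      abs_of_nonneg hcε, ENNReal.toReal_ofReal hcε, ← measureReal_def] at h1
    refine h1.trans_eq ?_
    have hR0 : 0 ≤ R := by positivity
    simp [measureReal_def, hR0]
  nlinarith [mul_le_mul_of_nonneg_left hlow hcε, Real.pi_pos]

/-- A consequence of **Gronwall's area theorem**: if `z⁻¹ + h z` is injective on the punctured unit
disc, with `h` holomorphic on the disc, then `‖deriv h 0‖ ≤ 1`. -/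
theorem norm_deriv_le_one_of_injOn_inv_add {h : ℂ → ℂ} (hh : DifferentiableOn ℂ h (ball 0 1))
    (hinj : InjOn (fun z ↦ z⁻¹ + h z) (ball 0 1 \ {0})) : ‖deriv h 0‖ ≤ 1 := by
  set c := ‖deriv h 0‖ with hc
  have hlim : ∀ r : ℝ, 0 < r → r < 1 → c ^ 2 * r ^ 2 - (r ^ 2)⁻¹ ≤ 0 := by
    intro r hr0 hr
    obtain ⟨C, hC⟩ := exists_norm_sub_le_mul_sq hh hr
    obtain ⟨D, hcD, hCD, hD⟩ : ∃ D, c ≤ D ∧ C ≤ D ∧ c * (c + C) ≤ D :=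
      ⟨max c (max C (c * (c + C))), by simp⟩
    have hev : ∀ᶠ ε in 𝓝[>] (0 : ℝ),
        (1 - c ^ 2 * ε ^ 4) * (-(r ^ 2)⁻¹ + c ^ 2 * (r ^ 2 - ε ^ 2)) - c ^ 2 * ε ^ 2 ≤
          4 * D * ε + 4 * D ^ 2 * ε ^ 4 := by
      have h1 : ∀ᶠ ε in 𝓝[>] (0 : ℝ), 6 * D * ε < 1 := by
        refine nhdsWithin_le_nhds (Tendsto.eventually_lt_const one_pos ?_)
        exact Continuous.tendsto' (by fun_prop) _ _ (by simp)
      filter_upwards [self_mem_nhdsWithin, nhdsWithin_le_nhds (Iio_mem_nhds hr0), h1]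
        with ε hε hεr hDε
      have hε : 0 < ε := hε
      have := one_sub_mul_le_of_injOn_inv_add hh hinj hr hC hcD hCD hD hε hεr hDε.le
      rw [← hc] at this
      have e1 : (1 - c ^ 2 * ε ^ 4) * ((ε ^ 2)⁻¹ - (r ^ 2)⁻¹ + c ^ 2 * (r ^ 2 - ε ^ 2)) =
          (ε ^ 2)⁻¹ - c ^ 2 * ε ^ 2
            + (1 - c ^ 2 * ε ^ 4) * (-(r ^ 2)⁻¹ + c ^ 2 * (r ^ 2 - ε ^ 2)) := by
        field_simp; ring
      have e2 : (ε⁻¹ + 2 * D * ε ^ 2) ^ 2 = (ε ^ 2)⁻¹ + 4 * D * ε + 4 * D ^ 2 * ε ^ 4 := by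
        field_simp; ring
      linarith
    refine le_of_tendsto_of_tendsto ?_ ?_ hev
    · refine tendsto_nhdsWithin_of_tendsto_nhds (Continuous.tendsto' (by fun_prop) _ _ ?_)
      ring
    · exact tendsto_nhdsWithin_of_tendsto_nhds (Continuous.tendsto' (by fun_prop) _ _ (by simp))
  have h1 : c ^ 2 * 1 ^ 2 - (1 ^ 2)⁻¹ ≤ 0 := by
    have ht : Tendsto (fun r : ℝ ↦ c ^ 2 * r ^ 2 - (r ^ 2)⁻¹) (𝓝[<] 1)
        (𝓝 (c ^ 2 * 1 ^ 2 - (1 ^ 2)⁻¹)) := by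
      refine tendsto_nhdsWithin_of_tendsto_nhds (ContinuousAt.tendsto (x := (1 : ℝ)) ?_)
      fun_prop (disch := norm_num)
    refine le_of_tendsto ht ?_
    filter_upwards [self_mem_nhdsWithin, nhdsWithin_le_nhds (Ioi_mem_nhds one_pos)] with r hr hr0
    exact hlim r hr0 hr
  have hc0 : 0 ≤ c := norm_nonneg _
  nlinarith

/-- A nonvanishing holomorphic function on the unit disc with value `1` at the origin has a
holomorphic logarithm. -/
theorem exists_exp_eq_of_ne_zero {F : ℂ → ℂ} (hF : DifferentiableOn ℂ F (ball 0 1))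
    (hF0 : ∀ z ∈ ball (0 : ℂ) 1, F z ≠ 0) (h1 : F 0 = 1) :
    ∃ L : ℂ → ℂ, L 0 = 0 ∧ (∀ z ∈ ball (0 : ℂ) 1, HasDerivAt L (deriv F z / F z) z) ∧
      ∀ z ∈ ball (0 : ℂ) 1, exp (L z) = F z := by
  have hq : DifferentiableOn ℂ (fun z ↦ deriv F z / F z) (ball 0 1) :=
    (hF.deriv isOpen_ball).div hF hF0
  obtain ⟨L, hL0, hL⟩ := hq.isExactOn_ball.with_val_at 0 0
  refine ⟨L, hL0, hL, fun z hz ↦ ?_⟩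
  have hd : ∀ w ∈ ball (0 : ℂ) 1, HasDerivAt (fun w ↦ F w * exp (-L w)) 0 w := by
    intro w hw
    have hFw := (hF.differentiableAt (isOpen_ball.mem_nhds hw)).hasDerivAt
    refine (hFw.mul (hL w hw).neg.cexp).congr_deriv ?_
    field_simp [hF0 w hw]
    ring
  have hconst := isOpen_ball.is_const_of_deriv_eq_zero (convex_ball (0 : ℂ) 1).isPreconnected
    (fun w hw ↦ (hd w hw).differentiableAt.differentiableWithinAt) (fun w hw ↦ (hd w hw).deriv)
    hz (mem_ball_self one_pos)
  simp only [hL0, h1, neg_zero, exp_zero, mul_one, exp_neg] at hconst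
  field_simp at hconst
  exact hconst.symm

theorem iteratedDeriv_two_id_mul {F : ℂ → ℂ} (hF : DifferentiableOn ℂ F (ball 0 1)) :
    iteratedDeriv 2 (fun z ↦ z * F z) 0 = 2 * deriv F 0 := by
  have hb : ball (0 : ℂ) 1 ∈ 𝓝 0 := ball_mem_nhds _ one_pos
  have hev : deriv (fun z ↦ z * F z) =ᶠ[𝓝 0] fun z ↦ F z + z * deriv F z := by
    filter_upwards [hb] with z hz
    have := (hasDerivAt_id z).mul (hF.differentiableAt (isOpen_ball.mem_nhds hz)).hasDerivAt
    refine this.deriv.trans ?_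
    simp
  rw [iteratedDeriv_succ, iteratedDeriv_one, hev.deriv_eq]
  have h1 := (hF.differentiableAt hb).hasDerivAt
  have h2 := ((hF.deriv isOpen_ball).differentiableAt hb).hasDerivAt
  refine (h1.add ((hasDerivAt_id _).mul h2)).deriv.trans ?_
  simp
  ring

/-- Bieberbach's 1916 inequality for the second Taylor coefficient of a
schlicht function: if `f` is holomorphic and injective on the open unit
disc with `f 0 = 0` and `f' 0 = 1`, then `|f''(0)/2| ≤ 2`. -/
theorem bieberbach_second_coeff (f : ℂ → ℂ)
    (hdiff : DifferentiableOn ℂ f (Metric.ball 0 1))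
    (hinj : Set.InjOn f (Metric.ball 0 1))
    (h0 : f 0 = 0) (h1 : deriv f 0 = 1) :
    ‖iteratedDeriv 2 f 0 / 2‖ ≤ 2 := by
  have hb : ball (0 : ℂ) 1 ∈ 𝓝 0 := ball_mem_nhds _ one_pos
  have h0b : (0 : ℂ) ∈ ball (0 : ℂ) 1 := mem_ball_self one_pos
  set F := dslope f 0 with hFdef
  have hF : DifferentiableOn ℂ F (ball 0 1) := (differentiableOn_dslope hb).2 hdiff
  have hfF (z : ℂ) : f z = z * F z := by simpa [h0] using (sub_smul_dslope f 0 z).symm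
  have hF1 : F 0 = 1 := by rw [hFdef, dslope_same, h1]
  have hFne : ∀ z ∈ ball (0 : ℂ) 1, F z ≠ 0 := by
    intro z hz hFz
    have hz0 : z = 0 := hinj hz h0b (by rw [hfF z, hFz, mul_zero, h0])
    rw [hz0, hF1] at hFz
    exact one_ne_zero hFz
  have hcoeff : iteratedDeriv 2 f 0 = 2 * deriv F 0 := by
    rw [show f = fun z ↦ z * F z from funext hfF, iteratedDeriv_two_id_mul hF]
  obtain ⟨L, hL0, hL, hLexp⟩ := exists_exp_eq_of_ne_zero hF hFne hF1
  set t : ℂ → ℂ := fun z ↦ exp (-L z / 2) with ht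
  have htd (z : ℂ) (hz : z ∈ ball (0 : ℂ) 1) :
      HasDerivAt t (t z * (-(deriv F z / F z) / 2)) z := ((hL z hz).neg.div_const 2).cexp
  have htF (z : ℂ) (hz : z ∈ ball (0 : ℂ) 1) : t z ^ 2 = (F z)⁻¹ := by
    rw [← hLexp z hz, ← exp_neg, ht, ← exp_nat_mul]
    congr 1
    push_cast
    ring
  have ht0 : t 0 = 1 := by simp [ht, hL0]
  have hu : DifferentiableOn ℂ (dslope t 0) (ball 0 1) :=
    (differentiableOn_dslope hb).2 fun z hz ↦ (htd z hz).differentiableAt.differentiableWithinAt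
  have htu (z : ℂ) : t z = 1 + z * dslope t 0 z := by
    have := sub_smul_dslope t 0 z
    rw [ht0, sub_zero, smul_eq_mul] at this
    rw [this]; ring
  have hsq {z : ℂ} (hz : z ∈ ball (0 : ℂ) 1) : z ^ 2 ∈ ball (0 : ℂ) 1 := by
    rw [mem_ball_zero_iff] at hz ⊢
    rw [norm_pow]
    exact pow_lt_one₀ (norm_nonneg _) hz two_ne_zero
  have husq : DifferentiableOn ℂ (fun z ↦ dslope t 0 (z ^ 2)) (ball 0 1) :=
    hu.comp (by fun_prop) fun z hz ↦ hsq hz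
  set h : ℂ → ℂ := fun z ↦ z * dslope t 0 (z ^ 2) with hh
  have hhd : DifferentiableOn ℂ h (ball 0 1) := differentiableOn_id.mul husq
  have hG {z : ℂ} (hz : z ≠ 0) : z⁻¹ + h z = z⁻¹ * t (z ^ 2) := by
    rw [htu]; simp only [hh]; field_simp
  have hGinj : InjOn (fun z ↦ z⁻¹ + h z) (ball 0 1 \ {0}) := by
    rintro z ⟨hz, hz0 : z ≠ 0⟩ w ⟨hw, hw0 : w ≠ 0⟩ hzw
    simp only [hG hz0, hG hw0] at hzw
    have hzw2 : z ^ 2 = w ^ 2 := by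
      refine hinj (hsq hz) (hsq hw) (inv_injective ?_)
      rw [hfF, hfF, mul_inv, mul_inv, ← htF _ (hsq hz), ← htF _ (hsq hw), ← inv_pow, ← inv_pow,
        ← mul_pow, ← mul_pow, hzw]
    rw [hzw2] at hzw
    exact inv_injective (mul_right_cancel₀ (exp_ne_zero _) hzw)
  have hderiv : deriv h 0 = -(deriv F 0) / 2 := by
    have hd := ((hasDerivAt_id (0 : ℂ)).mul (husq.differentiableAt hb).hasDerivAt).deriv
    have hd0 : deriv h 0 = dslope t 0 0 := by
      refine hd.trans ?_
      simp
    rw [hd0, dslope_same, (htd 0 h0b).deriv, ht0, hF1]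
    ring
  have hle := norm_deriv_le_one_of_injOn_inv_add hhd hGinj
  rw [hderiv, norm_div, norm_neg, RCLike.norm_ofNat, div_le_one two_pos] at hle
  rwa [hcoeff, mul_div_cancel_left₀ _ two_ne_zero]
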